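/- Let (X, d_X) and (Y, d_Y) be complete separable metric spaces (not necessarily compact) with Borel probability measures μ and ν, and let c : X × Y → [0, ∞) satisfy the Lipschitz condition |c(x, y) − c(x′, y′)| ≤ λ (d_X(x, x′) + d_Y(y, y′)) for all x, x′ ∈ X, y, y′ ∈ Y. Let S ⊆ X and T ⊆ Y be finite sets with measurable Voronoi cells, discrete measures μ_S and ν_T, and suppose h = max(φ_X(S), φ_Y(T)) is finite. Then |T_c(μ, ν) − T_c(μ_S, ν_T)| ≤ 2λh. -/

import Mathlib

open MeasureTheory

/-- `{V i}` is a collection of Voronoi cells for the finite point set `{s i}`: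
pairwise disjoint sets covering `X` with `O_i ⊆ V_i ⊆ C_i`. -/
def IsVoronoi {X : Type*} [MetricSpace X] {m : ℕ} (s : Fin m → X) (V : Fin m → Set X) : Prop :=
  Pairwise (Function.onFun Disjoint V) ∧ (⋃ i, V i) = Set.univ ∧
    ∀ i, {x : X | ∀ j, j ≠ i → dist x (s i) < dist x (s j)} ⊆ V i ∧
      V i ⊆ {x : X | ∀ j, j ≠ i → dist x (s i) ≤ dist x (s j)}

/-- The fill distance of the finite point set `{s i}` in `X`: the supremum of the radii
`r > 0` such that some open ball of radius `r` contains no point of the set. -/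
noncomputable def fillDist {X : Type*} [MetricSpace X] {m : ℕ} (s : Fin m → X) : ℝ :=
  sSup {r : ℝ | 0 < r ∧ ∃ x : X, ∀ i, r ≤ dist x (s i)}

/-- The discrete measure `μ_S = ∑ i μ(V i) δ_{s i}` associated to a measure `μ`, points
`{s i}` and Voronoi cells `{V i}`. -/
noncomputable def discMeas {X : Type*} [MeasurableSpace X] (μ : Measure X)
    {m : ℕ} (s : Fin m → X) (V : Fin m → Set X) : Measure X :=
  ∑ i, μ (V i) • Measure.dirac (s i)

/-- `Π(μ, ν)`: Borel probability measures on `X × Y` with marginals `μ` and `ν`. -/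
def Plans {X Y : Type*} [MeasurableSpace X] [MeasurableSpace Y]
    (μ : Measure X) (ν : Measure Y) : Set (Measure (X × Y)) :=
  {π | IsProbabilityMeasure π ∧ π.map Prod.fst = μ ∧ π.map Prod.snd = ν}

/-- The optimal transport cost `T_c(μ, ν) = inf_{π ∈ Π(μ,ν)} ∫ c dπ`. -/
noncomputable def Tcost {X Y : Type*} [MeasurableSpace X] [MeasurableSpace Y]
    (c : X × Y → ℝ) (μ : Measure X) (ν : Measure Y) : ℝ :=
  sInf {t : ℝ | ∃ π ∈ Plans μ ν, t = ∫ q, c q ∂π}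

/-- The modulus of continuity `ω_c(α) = sup { |c(x,y) - c(x',y')| : d(x,x') + d(y,y') < α }`. -/
noncomputable def omegaMod {X Y : Type*} [MetricSpace X] [MetricSpace Y]
    (c : X × Y → ℝ) (α : ℝ) : ℝ :=
  sSup {t : ℝ | ∃ x x' y y', dist x x' + dist y y' < α ∧ t = |c (x, y) - c (x', y')|}

lemma Tcost_le_add {X Y : Type*} [MeasurableSpace X] [MeasurableSpace Y]
    {c : X × Y → ℝ} (hc0 : ∀ q, 0 ≤ c q) {μ μ' : Measure X} {ν ν' : Measure Y} {K : ℝ}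
    (hne : (Plans μ' ν').Nonempty)
    (h : ∀ π' ∈ Plans μ' ν', ∃ π ∈ Plans μ ν, ∫ q, c q ∂π ≤ ∫ q, c q ∂π' + K) :
    Tcost c μ ν ≤ Tcost c μ' ν' + K := by
  rw [← sub_le_iff_le_add]
  obtain ⟨π₀, hπ₀⟩ := hne
  refine le_csInf ⟨_, π₀, hπ₀, rfl⟩ ?_
  rintro _ ⟨π', hπ', rfl⟩
  obtain ⟨π, hπ, hle⟩ := h π' hπ'
  rw [sub_le_iff_le_add]
  refine le_trans (csInf_le ⟨0, ?_⟩ ⟨π, hπ, rfl⟩) hle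
  rintro _ ⟨ρ, -, rfl⟩
  exact integral_nonneg hc0

lemma prod_mem_Plans {X Y : Type*} [MeasurableSpace X] [MeasurableSpace Y]
    (μ : Measure X) (ν : Measure Y) [IsProbabilityMeasure μ] [IsProbabilityMeasure ν] :
    μ.prod ν ∈ Plans μ ν :=
  ⟨inferInstance, by simp [Measure.map_fst_prod], by simp [Measure.map_snd_prod]⟩

lemma map_prodMap_mem_Plans {X Y : Type*} [MeasurableSpace X] [MeasurableSpace Y]
    {μ : Measure X} {ν : Measure Y} {P : X → X} {Q : Y → Y}
    (hP : Measurable P) (hQ : Measurable Q) {π : Measure (X × Y)} (hπ : π ∈ Plans μ ν) :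
    π.map (Prod.map P Q) ∈ Plans (μ.map P) (ν.map Q) := by
  obtain ⟨hπ1, rfl, rfl⟩ := hπ
  refine ⟨Measure.isProbabilityMeasure_map (hP.prodMap hQ).aemeasurable, ?_, ?_⟩
  · rw [Measure.map_map measurable_fst (hP.prodMap hQ), Measure.map_map hP measurable_fst]
    rfl
  · rw [Measure.map_map measurable_snd (hP.prodMap hQ), Measure.map_map hQ measurable_snd]
    rfl

lemma map_fst_withDensity_prod {X Y : Type*} [MeasurableSpace X] [MeasurableSpace Y]
    (μ : Measure X) (ν : Measure Y) [SFinite μ] [SFinite ν]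
    {g : X × Y → ENNReal} (hg : Measurable g) :
    ((μ.prod ν).withDensity g).map Prod.fst = μ.withDensity (fun x => ∫⁻ y, g (x, y) ∂ν) := by
  ext A hA
  rw [Measure.map_apply measurable_fst hA, withDensity_apply _ (measurable_fst hA),
    withDensity_apply _ hA, ← Set.prod_univ, ← Measure.prod_restrict,
    lintegral_prod _ hg.aemeasurable, Measure.restrict_univ]

lemma map_fst_withDensity_comp {X Y X' Y' : Type*} [MeasurableSpace X] [MeasurableSpace Y]
    [MeasurableSpace X'] [MeasurableSpace Y']
    (μ : Measure X) (ν : Measure Y) [IsFiniteMeasure μ] [IsFiniteMeasure ν]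
    {P : X → X'} {Q : Y → Y'} (hP : Measurable P) (hQ : Measurable Q)
    {g : X' × Y' → ENNReal} (hg : Measurable g)
    (h : (((μ.map P).prod (ν.map Q)).withDensity g).map Prod.fst = μ.map P) :
    ((μ.prod ν).withDensity (g ∘ Prod.map P Q)).map Prod.fst = μ := by
  rw [map_fst_withDensity_prod _ _ hg] at h
  have hG : Measurable fun x => ∫⁻ y, g (x, y) ∂(ν.map Q) := hg.lintegral_prod_right'
  have h1 : (fun x => ∫⁻ y, g (x, y) ∂(ν.map Q)) =ᵐ[μ.map P] fun _ => 1 := by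
    rw [← withDensity_eq_iff_of_sigmaFinite hG.aemeasurable aemeasurable_const, h]
    exact withDensity_one.symm
  have h2 := ae_of_ae_map hP.aemeasurable h1
  rw [map_fst_withDensity_prod _ _ (hg.comp (hP.prodMap hQ))]
  conv_rhs => rw [← withDensity_one (μ := μ)]
  refine withDensity_congr_ae ?_
  filter_upwards [h2] with x hx
  rw [lintegral_map (f := fun y => g (P x, y)) (hg.comp measurable_prodMk_left) hQ] at hx
  exact hx

lemma map_snd_withDensity_prod {X Y : Type*} [MeasurableSpace X] [MeasurableSpace Y]
    (μ : Measure X) (ν : Measure Y) [SFinite μ] [SFinite ν]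
    {g : X × Y → ENNReal} (hg : Measurable g) :
    ((μ.prod ν).withDensity g).map Prod.snd
      = ((ν.prod μ).withDensity (g ∘ Prod.swap)).map Prod.fst := by
  ext E hE
  rw [Measure.map_apply measurable_snd hE, Measure.map_apply measurable_fst hE,
    withDensity_apply _ (measurable_snd hE), withDensity_apply _ (measurable_fst hE),
    ← Measure.prod_swap (μ := ν) (ν := μ),
    setLIntegral_map (measurable_snd hE) hg measurable_swap]
  rfl

lemma map_snd_withDensity_comp {X Y X' Y' : Type*} [MeasurableSpace X] [MeasurableSpace Y]
    [MeasurableSpace X'] [MeasurableSpace Y']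
    (μ : Measure X) (ν : Measure Y) [IsFiniteMeasure μ] [IsFiniteMeasure ν]
    {P : X → X'} {Q : Y → Y'} (hP : Measurable P) (hQ : Measurable Q)
    {g : X' × Y' → ENNReal} (hg : Measurable g)
    (h : (((μ.map P).prod (ν.map Q)).withDensity g).map Prod.snd = ν.map Q) :
    ((μ.prod ν).withDensity (g ∘ Prod.map P Q)).map Prod.snd = ν := by
  rw [map_snd_withDensity_prod _ _ hg] at h
  rw [map_snd_withDensity_prod μ ν (hg.comp (hP.prodMap hQ))]
  have hcomm : (g ∘ Prod.map P Q) ∘ Prod.swap = (g ∘ Prod.swap) ∘ Prod.map Q P := rfl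
  rw [hcomm]
  exact map_fst_withDensity_comp ν μ hQ hP (hg.comp measurable_swap) h

/-- A plan between pushforwards that is absolutely continuous with respect to the product plan
lifts to a plan between the original measures. -/
lemma exists_Plans_map_eq {X Y : Type*} [MeasurableSpace X] [MeasurableSpace Y]
    {μ : Measure X} {ν : Measure Y} [IsProbabilityMeasure μ] [IsProbabilityMeasure ν]
    {P : X → X} {Q : Y → Y} (hP : Measurable P) (hQ : Measurable Q) {π' : Measure (X × Y)}
    (hπ' : π' ∈ Plans (μ.map P) (ν.map Q)) (hac : π' ≪ (μ.map P).prod (ν.map Q)) :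
    ∃ π ∈ Plans μ ν, π.map (Prod.map P Q) = π' := by
  obtain ⟨hprob, h1, h2⟩ := hπ'
  set g := π'.rnDeriv ((μ.map P).prod (ν.map Q))
  have hg : Measurable g := Measure.measurable_rnDeriv _ _
  have hd : ((μ.map P).prod (ν.map Q)).withDensity g = π' := Measure.withDensity_rnDeriv_eq _ _ hac
  have hf := map_fst_withDensity_comp μ ν hP hQ hg (by rw [hd, h1])
  have hs := map_snd_withDensity_comp μ ν hP hQ hg (by rw [hd, h2])
  refine ⟨_, ⟨⟨?_⟩, hf, hs⟩, ?_⟩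
  · have := congrArg (fun ρ => ρ Set.univ) hf
    simpa [Measure.map_apply measurable_fst MeasurableSet.univ] using this
  · conv_rhs => rw [← hd]
    ext E hE
    have hPQ := hP.prodMap hQ
    rw [Measure.map_apply hPQ hE, withDensity_apply _ (hPQ hE), withDensity_apply _ hE,
      Measure.map_prod_map _ _ hP hQ, setLIntegral_map hE hg hPQ]
    rfl

lemma Plans.absolutelyContinuous_prod {X Y : Type*} [MeasurableSpace X] [MeasurableSpace Y]
    [MeasurableSingletonClass X] [MeasurableSingletonClass Y]
    {μ : Measure X} {ν : Measure Y} [SFinite ν] {π : Measure (X × Y)} (hπ : π ∈ Plans μ ν)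
    {A : Set X} {B : Set Y} (hA : A.Countable) (hB : B.Countable)
    (hμ : μ Aᶜ = 0) (hν : ν Bᶜ = 0) : π ≪ μ.prod ν := by
  obtain ⟨-, rfl, rfl⟩ := hπ
  intro E hE
  rw [Measure.map_apply measurable_fst hA.measurableSet.compl] at hμ
  rw [Measure.map_apply measurable_snd hB.measurableSet.compl] at hν
  have hsub : E ⊆ (E ∩ A ×ˢ B) ∪ (Prod.fst ⁻¹' Aᶜ ∪ Prod.snd ⁻¹' Bᶜ) := by
    intro q hq
    by_cases ha : q.1 ∈ A <;> by_cases hb : q.2 ∈ B <;> simp [*]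
  refine measure_mono_null hsub (measure_union_null ?_ (measure_union_null hμ hν))
  rw [measure_null_iff_singleton ((hA.prod hB).mono Set.inter_subset_right)]
  rintro ⟨a, b⟩ ⟨hab, -⟩
  have h0 := measure_mono_null (Set.singleton_subset_iff.2 hab) hE
  rw [← Set.singleton_prod_singleton, Measure.prod_prod, mul_eq_zero,
    Measure.map_apply measurable_fst (measurableSet_singleton _),
    Measure.map_apply measurable_snd (measurableSet_singleton _)] at h0
  rcases h0 with h0 | h0
  · exact measure_mono_null (by rintro _ rfl; rfl) h0
  · exact measure_mono_null (by rintro _ rfl; rfl) h0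

lemma discMeas_compl_range {X : Type*} [MeasurableSpace X] [MeasurableSingletonClass X]
    (μ : Measure X) {m : ℕ} (s : Fin m → X) (V : Fin m → Set X) :
    discMeas μ s V (Set.range s)ᶜ = 0 := by
  have hm : MeasurableSet (Set.range s)ᶜ := (Set.finite_range s).measurableSet.compl
  simp [discMeas, hm]

/-- Sending each Voronoi cell to its centre is a measurable map that pushes `μ` to `μ_S` and moves
points by at most the fill distance. -/
lemma IsVoronoi.exists_projection {X : Type*} [MetricSpace X] [MeasurableSpace X]
    (μ : Measure X) {m : ℕ} {s : Fin m → X} {V : Fin m → Set X}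
    (hV : IsVoronoi s V) (hVm : ∀ i, MeasurableSet (V i)) {φ : ℝ}
    (hφ : IsLUB {r : ℝ | 0 < r ∧ ∃ x : X, ∀ i, r ≤ dist x (s i)} φ) :
    ∃ P : X → X, Measurable P ∧ μ.map P = discMeas μ s V ∧ (∀ x, dist x (P x) ≤ φ) ∧
      ∀ x, P x ∈ Set.range s := by
  obtain ⟨hdisj, hcov, hcell⟩ := hV
  have hex : ∀ x, ∃ i, x ∈ V i := fun x => Set.mem_iUnion.1 (hcov ▸ Set.mem_univ x)
  choose idx hidx using hex
  have hpre : ∀ i, idx ⁻¹' {i} = V i := by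
    intro i
    ext x
    refine ⟨fun h => h ▸ hidx x, fun h => ?_⟩
    by_contra hne
    exact Set.disjoint_left.1 (hdisj hne) (hidx x) h
  have hidxm : Measurable idx := measurable_to_countable' fun i => hpre i ▸ hVm i
  have hs : Measurable s := measurable_of_countable s
  refine ⟨s ∘ idx, hs.comp hidxm, ?_, fun x => ?_, fun x => ⟨idx x, rfl⟩⟩
  · rw [← Measure.map_map hs hidxm, ← Measure.sum_smul_dirac (μ.map idx), Measure.sum_fintype]
    simp only [discMeas, Measure.map_apply hidxm (measurableSet_singleton _), hpre]
    ext A hA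
    simp [Measure.map_apply hs hA, Measure.dirac_apply' _ hA, Measure.dirac_apply' _ (hs hA)]
    rfl
  · rcases (dist_nonneg (x := x) (y := s (idx x))).eq_or_lt with h0 | hpos
    · obtain ⟨r, hr⟩ := hφ.nonempty
      simpa [← h0] using hr.1.le.trans (hφ.1 hr)
    · refine hφ.1 ⟨hpos, x, fun j => ?_⟩
      by_cases hj : j = idx x
      · rw [hj]; rfl
      · exact (hcell _).2 (hidx x) j hj

lemma isBounded_univ_of_dist_le {X : Type*} [PseudoMetricSpace X] {A : Set X}
    (hA : Bornology.IsBounded A) {P : X → X} {φ : ℝ} (hP : ∀ x, dist x (P x) ≤ φ)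
    (hPA : ∀ x, P x ∈ A) : Bornology.IsBounded (Set.univ : Set X) :=
  hA.cthickening.subset fun x _ => Metric.mem_cthickening_of_dist_le x (P x) φ A (hPA x) (hP x)

lemma abs_integral_sub_integral_map_le {Z : Type*} [MeasurableSpace Z] {c : Z → ℝ}
    (hcm : Measurable c) {C : ℝ} (hC : ∀ z, |c z| ≤ C) {F : Z → Z} (hF : Measurable F) {K : ℝ}
    (hK : ∀ z, |c z - c (F z)| ≤ K) (π : Measure Z) [IsProbabilityMeasure π] :
    |∫ z, c z ∂π - ∫ z, c z ∂(π.map F)| ≤ K := by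
  have h1 : Integrable c π :=
    .of_bound hcm.aestronglyMeasurable C (Filter.Eventually.of_forall hC)
  have h2 : Integrable (fun z => c (F z)) π :=
    .of_bound (hcm.comp hF).aestronglyMeasurable C (Filter.Eventually.of_forall fun z => hC (F z))
  rw [integral_map hF.aemeasurable hcm.aestronglyMeasurable, ← integral_sub h1 h2]
  simpa using norm_integral_le_of_norm_le_const (μ := π) (f := fun z => c z - c (F z))
    (Filter.Eventually.of_forall hK)


/-- Corollary D.6: the Lipschitz bound `|T_c(μ, ν) - T_c(μ_S, ν_T)| ≤ 2λh` extends to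
complete separable (not necessarily compact) metric spaces, provided the fill distances
`φ_X(S), φ_Y(T)` are finite (i.e. are genuine least upper bounds `φX, φY ∈ ℝ`), with
`h = max(φ_X(S), φ_Y(T))`. -/
theorem transport_cost_lipschitz_approx_polish
    {X Y : Type*} [MetricSpace X] [CompleteSpace X] [TopologicalSpace.SeparableSpace X]
    [MetricSpace Y] [CompleteSpace Y] [TopologicalSpace.SeparableSpace Y]
    [MeasurableSpace X] [BorelSpace X] [MeasurableSpace Y] [BorelSpace Y]
    (μ : Measure X) (ν : Measure Y) [IsProbabilityMeasure μ] [IsProbabilityMeasure ν]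
    (c : X × Y → ℝ) (hc0 : ∀ q, 0 ≤ c q) (lam : ℝ)
    (hcL : ∀ (x x' : X) (y y' : Y),
      |c (x, y) - c (x', y')| ≤ lam * (dist x x' + dist y y'))
    {m n : ℕ} (s : Fin m → X) (t : Fin n → Y)
    (V : Fin m → Set X) (W : Fin n → Set Y)
    (hVvor : IsVoronoi s V) (hWvor : IsVoronoi t W)
    (hVm : ∀ i, MeasurableSet (V i)) (hWm : ∀ j, MeasurableSet (W j))
    (φX φY : ℝ)
    (hφX : IsLUB {r : ℝ | 0 < r ∧ ∃ x : X, ∀ i, r ≤ dist x (s i)} φX)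
    (hφY : IsLUB {r : ℝ | 0 < r ∧ ∃ y : Y, ∀ j, r ≤ dist y (t j)} φY) :
    |Tcost c μ ν - Tcost c (discMeas μ s V) (discMeas ν t W)|
      ≤ 2 * lam * max φX φY := by
  obtain ⟨P, hP, hPμ, hPd, hPs⟩ := hVvor.exists_projection μ hVm hφX
  obtain ⟨Q, hQ, hQν, hQd, hQt⟩ := hWvor.exists_projection ν hWm hφY
  have := UniformSpace.secondCountable_of_separable X
  have := UniformSpace.secondCountable_of_separable Y
  obtain ⟨y₀⟩ : Nonempty Y := nonempty_of_isProbabilityMeasure ν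
  obtain ⟨x₀⟩ : Nonempty X := nonempty_of_isProbabilityMeasure μ
  have hlam : 0 ≤ lam := by
    obtain ⟨r, hr, x, hx⟩ := hφX.nonempty
    obtain ⟨i, -⟩ := hPs x
    have h := (abs_nonneg _).trans (hcL x (s i) y₀ y₀)
    rw [dist_self, add_zero] at h
    exact nonneg_of_mul_nonneg_left h (hr.trans_le (hx i))
  have hcm : Measurable c := by
    refine Continuous.measurable (LipschitzWith.continuous (K := (2 * lam).toNNReal)
      (LipschitzWith.of_dist_le_mul fun p q => ?_))
    rw [Real.coe_toNNReal _ (by positivity), Real.dist_eq, Prod.dist_eq]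
    calc _ ≤ _ := hcL p.1 q.1 p.2 q.2
      _ ≤ lam * (max (dist p.1 q.1) (dist p.2 q.2) + max (dist p.1 q.1) (dist p.2 q.2)) := by
        gcongr
        exacts [le_max_left _ _, le_max_right _ _]
      _ = _ := by ring
  obtain ⟨C, hC⟩ : ∃ C, ∀ q, |c q| ≤ C := by
    obtain ⟨CX, hCX⟩ := Metric.isBounded_iff.1
      (isBounded_univ_of_dist_le (Set.finite_range s).isBounded hPd hPs)
    obtain ⟨CY, hCY⟩ := Metric.isBounded_iff.1
      (isBounded_univ_of_dist_le (Set.finite_range t).isBounded hQd hQt)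
    refine ⟨lam * (CX + CY) + |c (x₀, y₀)|, fun q => ?_⟩
    have h1 := hcL q.1 x₀ q.2 y₀
    have h2 : lam * (dist q.1 x₀ + dist q.2 y₀) ≤ lam * (CX + CY) := by
      gcongr
      exacts [hCX trivial trivial, hCY trivial trivial]
    have h3 := abs_sub_abs_le_abs_sub (c q) (c (x₀, y₀))
    linarith
  have hK : ∀ q, |c q - c (Prod.map P Q q)| ≤ 2 * lam * max φX φY := fun q => by
    calc _ ≤ _ := hcL q.1 (P q.1) q.2 (Q q.2)
      _ ≤ lam * (max φX φY + max φX φY) := by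
        gcongr
        exacts [(hPd _).trans (le_max_left _ _), (hQd _).trans (le_max_right _ _)]
      _ = _ := by ring
  have hmem : ∀ π ∈ Plans μ ν,
      |∫ q, c q ∂π - ∫ q, c q ∂(π.map (Prod.map P Q))| ≤ 2 * lam * max φX φY := fun π hπ => by
    have := hπ.1
    exact abs_integral_sub_integral_map_le hcm hC (hP.prodMap hQ) hK π
  have hne := prod_mem_Plans μ ν
  have hne' := map_prodMap_mem_Plans hP hQ hne
  have hle : Tcost c μ ν ≤ Tcost c (μ.map P) (ν.map Q) + 2 * lam * max φX φY := by
    refine Tcost_le_add hc0 ⟨_, hne'⟩ fun π' hπ' => ?_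
    have hac := Plans.absolutelyContinuous_prod hπ' (Set.finite_range s).countable
      (Set.finite_range t).countable (hPμ ▸ discMeas_compl_range μ s V)
      (hQν ▸ discMeas_compl_range ν t W)
    obtain ⟨π, hπ, rfl⟩ := exists_Plans_map_eq hP hQ hπ' hac
    exact ⟨π, hπ, by linarith [(abs_le.1 (hmem π hπ)).2]⟩
  have hge : Tcost c (μ.map P) (ν.map Q) ≤ Tcost c μ ν + 2 * lam * max φX φY :=
    Tcost_le_add hc0 ⟨_, hne⟩ fun π hπ =>
      ⟨_, map_prodMap_mem_Plans hP hQ hπ, by linarith [(abs_le.1 (hmem π hπ)).1]⟩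
  rw [← hPμ, ← hQν, abs_le]
  constructor <;> linarith
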